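/- arXiv:2404.16723 — 3 statements merged into one kernel-verified Lean document; each statement's English description precedes it below -/
import Mathlib

section
/- Let α be a type, let r : α → α → Prop be irreflexive and transitive, let S be a set in α, and let s : α → α → Prop be a relation such that: s u v implies u ∈ S and v ∈ S; s is irreflexive and transitive; s is total on S (for all distinct u, v ∈ S, s u v or s v u); and s extends r on S (for all u, v ∈ S, r u v implies s u v). Then the transitive closure of the union relation t, defined by t u v ↔ (r u v ∨ s u v), is irreflexive; in other words, t admits no cycle. -/
/-- A chain of steps from `r` or `s` collapses to a single step of `r`, or to a single step
of `s` possibly preceded and followed by a step of `r`. -/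
theorem rel_or_exists_of_transGen_union {α : Type*} {r s : α → α → Prop} {S : Set α}
    (hr_trans : Transitive r) (hs_mem : ∀ u v, s u v → u ∈ S ∧ v ∈ S) (hs_trans : Transitive s)
    (hs_ext : ∀ u ∈ S, ∀ v ∈ S, r u v → s u v) {a b : α}
    (h : Relation.TransGen (fun u v => r u v ∨ s u v) a b) :
    r a b ∨ ∃ u v, s u v ∧ (a = u ∨ r a u) ∧ (v = b ∨ r v b) := by
  induction h with
  | single h =>
    exact h.imp_right fun h => ⟨_, _, h, .inl rfl, .inl rfl⟩
  | tail _ hbc ih =>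
    rcases ih with hab | ⟨u, v, huv, hau, rfl | hvb⟩ <;> rcases hbc with hbc | hbc
    · exact .inl (hr_trans hab hbc)
    · exact .inr ⟨_, _, hbc, .inr hab, .inl rfl⟩
    · exact .inr ⟨u, _, huv, hau, .inr hbc⟩
    · exact .inr ⟨u, _, hs_trans huv hbc, hau, .inl rfl⟩
    · exact .inr ⟨u, v, huv, hau, .inr (hr_trans hvb hbc)⟩
    · have hvb' := hs_ext _ (hs_mem _ _ huv).2 _ (hs_mem _ _ hbc).1 hvb
      exact .inr ⟨u, _, hs_trans huv (hs_trans hvb' hbc), hau, .inl rfl⟩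

/-- Let `r` be an irreflexive transitive relation on `α`, let `S` be a set, and let `s` be
an irreflexive transitive relation supported on `S`, total on `S`, and extending `r` on `S`.
Then the transitive closure of the union of `r` and `s` is irreflexive, i.e. the union
relation admits no cycle. -/
theorem transGen_union_irrefl {α : Type*} (r s : α → α → Prop) (S : Set α)
    (hr_irrefl : ∀ a, ¬ r a a) (hr_trans : Transitive r)
    (hs_mem : ∀ u v, s u v → u ∈ S ∧ v ∈ S)
    (hs_irrefl : ∀ a, ¬ s a a) (hs_trans : Transitive s)
    (hs_total : ∀ u ∈ S, ∀ v ∈ S, u ≠ v → s u v ∨ s v u)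
    (hs_ext : ∀ u ∈ S, ∀ v ∈ S, r u v → s u v) :
    ∀ a, ¬ Relation.TransGen (fun u v => r u v ∨ s u v) a a := by
  intro a h
  rcases rel_or_exists_of_transGen_union hr_trans hs_mem hs_trans hs_ext h with
    h | ⟨u, v, huv, hau, hva⟩
  · exact hr_irrefl a h
  · have hvu : v = u ∨ r v u := by
      rcases hva with rfl | hva
      · exact hau
      · rcases hau with rfl | hau
        · exact .inr hva
        · exact .inr (hr_trans hva hau)
    rcases hvu with rfl | hvu
    · exact hs_irrefl v huv
    · obtain ⟨hu, hv⟩ := hs_mem u v huv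
      exact hs_irrefl u (hs_trans huv (hs_ext v hv u hu hvu))
end

section
/- Let G be a finite simple planar graph and let C be a vertex cover of G with |C| = k. Then the number of vertices v ∉ C whose degree is at least 3 is at most 2k. -/
open Set

/-- A planar drawing of a simple graph: an injective placement of the vertices in the
plane together with, for each edge, a continuous injective curve joining the points of
its endpoints, such that curves of distinct edges intersect only in images of common
endpoints and no curve passes through the point of a vertex that is not an endpoint of
its edge. -/
structure PlanarDrawing {V : Type} (G : SimpleGraph V) where
  p : V → ℝ × ℝ
  c : V → V → ℝ → ℝ × ℝ
  p_inj : Function.Injective p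
  c_cont : ∀ u v, G.Adj u v → ContinuousOn (c u v) (Icc 0 1)
  c_injOn : ∀ u v, G.Adj u v → InjOn (c u v) (Icc 0 1)
  c_start : ∀ u v, G.Adj u v → c u v 0 = p u
  c_end : ∀ u v, G.Adj u v → c u v 1 = p v
  c_symm : ∀ u v, G.Adj u v → ∀ t, c v u t = c u v (1 - t)
  c_cross : ∀ u v x y, G.Adj u v → G.Adj x y → ({u, v} : Set V) ≠ {x, y} →
    ∀ s ∈ Icc (0:ℝ) 1, ∀ t ∈ Icc (0:ℝ) 1, c u v s = c x y t →
      ∃ w : V, (w = u ∨ w = v) ∧ (w = x ∨ w = y) ∧ c u v s = p w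
  c_vertex : ∀ u v, G.Adj u v → ∀ t ∈ Icc (0:ℝ) 1, ∀ w : V, c u v t = p w → w = u ∨ w = v

theorem exists_continuous_log_of_plane {g : ℝ × ℝ → ℂ} (hg : Continuous g) (h0 : ∀ x, g x ≠ 0) :
    ∃ L : ℝ × ℝ → ℂ, Continuous L ∧ ∀ x, Complex.exp (L x) = g x := by
  have hU : IsSimplyConnected (univ : Set (ℝ × ℝ)) := by
    have : ContractibleSpace (univ : Set (ℝ × ℝ)) := convex_univ.contractibleSpace univ_nonempty
    exact inferInstanceAs (SimplyConnectedSpace (univ : Set (ℝ × ℝ)))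
  obtain ⟨L, hL, hexp⟩ := Complex.exists_continuousOn_eqOn_exp_comp hU isOpen_univ hg.continuousOn
    (by rintro ⟨x, -, hx⟩; exact h0 x hx)
  exact ⟨L, continuousOn_univ.1 hL, fun x => hexp (mem_univ x)⟩

theorem log_increment_eq {l m : ℝ → ℂ} (hl : Continuous l) (hm : Continuous m) (κ : ℂ)
    (h : ∀ t, Complex.exp (l t) = κ * Complex.exp (m t)) : l 1 - l 0 = m 1 - m 0 := by
  have hc : ∀ t, Complex.exp (l t - m t) = κ := fun t => by
    rw [Complex.exp_sub, h t, mul_div_cancel_right₀ _ (Complex.exp_ne_zero _)]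
  have := Complex.isCoveringMap_exp.const_of_comp (g := fun t => l t - m t) (hl.sub hm)
    (fun a a' => Subtype.ext ((hc a).trans (hc a').symm)) 0 1
  linear_combination -this

open Classical in
/-- The total increment over `[0, 1]` of a continuous logarithm of `g`. -/
noncomputable def logIncrement (g : ℝ → ℂ) : ℂ :=
  if h : ∃ l : ℝ → ℂ, Continuous l ∧ ∀ t, Complex.exp (l t) = g t
  then h.choose 1 - h.choose 0 else 0

theorem logIncrement_eq {g l : ℝ → ℂ} (hl : Continuous l) (κ : ℂ) (hκ : κ ≠ 0)
    (h : ∀ t, Complex.exp (l t) = κ * g t) : logIncrement g = l 1 - l 0 := by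
  have hex : ∃ l : ℝ → ℂ, Continuous l ∧ ∀ t, Complex.exp (l t) = g t := by
    refine ⟨fun t => l t - Complex.log κ, hl.sub continuous_const, fun t => ?_⟩
    rw [Complex.exp_sub, h t, Complex.exp_log hκ, mul_div_cancel_left₀ _ hκ]
  rw [logIncrement, dif_pos hex]
  obtain ⟨hc, he⟩ := hex.choose_spec
  exact (log_increment_eq hl hc κ fun t => by rw [h t, he t]).symm

theorem logIncrement_square {f g : ℝ → ℂ} (hf : Continuous f) (hg : Continuous g)
    (h : ∀ s t, f s ≠ g t) :
    logIncrement (fun t => f t - g 0) - logIncrement (fun t => f t - g 1)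
      + logIncrement (fun t => g t - f 1) - logIncrement (fun t => g t - f 0) = 0 := by
  obtain ⟨L, hL, he⟩ := exists_continuous_log_of_plane (g := fun x => f x.1 - g x.2)
    (by fun_prop) (fun x => sub_ne_zero.2 (h _ _))
  rw [logIncrement_eq (l := fun t => L (t, 0)) (by fun_prop) 1 one_ne_zero (by simp [he]),
    logIncrement_eq (l := fun t => L (t, 1)) (by fun_prop) 1 one_ne_zero (by simp [he]),
    logIncrement_eq (l := fun t => L (1, t)) (by fun_prop) (-1) (by simp) (by simp [he]),
    logIncrement_eq (l := fun t => L (0, t)) (by fun_prop) (-1) (by simp) (by simp [he])]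
  ring

theorem exists_logIncrement_eq {f : ℝ → ℂ} (hf : Continuous f) {z x y : ℂ}
    (h : ∀ t, f t ≠ z) (hx : Complex.exp x = f 0 - z) (hy : Complex.exp y = f 1 - z) :
    ∃ n : ℤ, logIncrement (fun t => f t - z) = y - x + n * (2 * Real.pi * Complex.I) := by
  obtain ⟨L, hL, he⟩ := exists_continuous_log_of_plane (g := fun x => f x.1 - z)
    (by fun_prop) (fun x => sub_ne_zero.2 (h _))
  rw [logIncrement_eq (l := fun t => L (t, 0)) (by fun_prop) 1 one_ne_zero (by simp [he])]
  obtain ⟨m, hm⟩ := Complex.exp_eq_exp_iff_exists_int.1 ((he (0, 0)).trans hx.symm)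
  obtain ⟨n, hn⟩ := Complex.exp_eq_exp_iff_exists_int.1 ((he (1, 0)).trans hy.symm)
  refine ⟨n - m, ?_⟩
  rw [hm, hn]
  push_cast
  ring

/-- A logarithm of `p j - p i`, with the logarithms for the two orders differing by `π * I`. -/
noncomputable def orderedLog {n : ℕ} (p : Fin n → ℂ) (i j : Fin n) : ℂ :=
  if i < j then Complex.log (p j - p i) else Complex.log (p i - p j) + Real.pi * Complex.I

theorem exp_orderedLog {n : ℕ} {p : Fin n → ℂ} {i j : Fin n} (h : p i ≠ p j) :
    Complex.exp (orderedLog p i j) = p j - p i := by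
  unfold orderedLog
  split_ifs
  · exact Complex.exp_log (sub_ne_zero.2 h.symm)
  · rw [Complex.exp_add, Complex.exp_log (sub_ne_zero.2 h), Complex.exp_pi_mul_I]
    ring

theorem orderedLog_sub {n : ℕ} (p : Fin n → ℂ) {i j : Fin n} (h : i < j) :
    orderedLog p j i - orderedLog p i j = Real.pi * Complex.I := by
  simp [orderedLog, h, h.not_gt]

/-- In every drawing of the complete bipartite graph on `3 + 3` vertices, two curves without a
common endpoint meet. -/
theorem exists_independent_curves_meet (a b : Fin 3 → ℂ) (f : Fin 3 → Fin 3 → ℝ → ℂ)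
    (hf : ∀ i j, Continuous (f i j)) (h0 : ∀ i j, f i j 0 = a i) (h1 : ∀ i j, f i j 1 = b j) :
    ∃ i i' j j', i ≠ i' ∧ j ≠ j' ∧ ∃ s t, f i j s = f i' j' t := by
  by_contra! hd
  have other : ∀ i : Fin 3, ∃ j, i ≠ j := by decide
  have haf : ∀ {i i'} j, i ≠ i' → ∀ t, f i j t ≠ a i' := fun {i i'} j hi t => by
    obtain ⟨j', hj⟩ := other j
    rw [← h0 i' j']
    exact hd _ _ _ _ hi hj _ _
  have hbf : ∀ {j j'} i, j ≠ j' → ∀ t, f i j t ≠ b j' := fun {j j'} i hj t => by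
    obtain ⟨i', hi⟩ := other i
    rw [← h1 i' j']
    exact hd _ _ _ _ hi hj _ _
  have haa : ∀ {i i'}, i ≠ i' → a i ≠ a i' := fun {i i'} hi => by
    simpa [h0] using haf 0 hi 0
  have hbb : ∀ {j j'}, j ≠ j' → b j ≠ b j' := fun {j j'} hj => by
    simpa [h1] using hbf 0 hj 1
  have hab : ∀ i j, a i ≠ b j := fun i j => by
    obtain ⟨j', hj⟩ := other j
    simpa [h0] using hbf i hj.symm 0
  set M : Fin 3 → Fin 3 → ℂ := fun i j => Complex.log (b j - a i)
  have expM : ∀ i j, Complex.exp (M i j) = b j - a i := fun i j =>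
    Complex.exp_log (sub_ne_zero.2 (hab i j).symm)
  have hα : ∀ i' i j, ∃ n : ℤ, i ≠ i' → logIncrement (fun t => f i j t - a i') =
      M i' j - orderedLog a i' i + n * (2 * Real.pi * Complex.I) := fun i' i j => by
    by_cases hi : i = i'
    · exact ⟨0, fun h => absurd hi h⟩
    · obtain ⟨n, hn⟩ := exists_logIncrement_eq (hf i j) (haf j hi)
        (x := orderedLog a i' i) (y := M i' j)
        (by rw [exp_orderedLog (haa (Ne.symm hi)), h0]) (by rw [expM, h1])
      exact ⟨n, fun _ => hn⟩
  have hβ : ∀ j' i j, ∃ n : ℤ, j ≠ j' → logIncrement (fun t => f i j t - b j') =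
      orderedLog b j' j - (M i j' + Real.pi * Complex.I) + n * (2 * Real.pi * Complex.I) :=
      fun j' i j => by
    by_cases hj : j = j'
    · exact ⟨0, fun h => absurd hj h⟩
    · obtain ⟨n, hn⟩ := exists_logIncrement_eq (hf i j) (hbf i hj)
        (x := M i j' + Real.pi * Complex.I) (y := orderedLog b j' j)
        (by rw [Complex.exp_add, expM, h0, Complex.exp_pi_mul_I]; ring)
        (by rw [exp_orderedLog (hbb (Ne.symm hj)), h1])
      exact ⟨n, fun _ => hn⟩
  choose α hα using hα
  choose β hβ using hβ
  have rel : ∀ i i' j j', i < i' → j ≠ j' →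
      α i' i j - β j' i j + β j i' j' - α i i' j' = if j < j' then 1 else 0 := by
    intro i i' j j' hi hj
    have hsq := logIncrement_square (hf i j) (hf i' j') (hd _ _ _ _ hi.ne hj)
    simp only [h0, h1] at hsq
    rw [hα i' i j hi.ne, hβ j' i j hj, hβ j i' j' hj.symm, hα i i' j' hi.ne'] at hsq
    have ha := orderedLog_sub a hi
    have hpi : (2 * Real.pi * Complex.I : ℂ) ≠ 0 := Complex.two_pi_I_ne_zero
    have key : ((α i' i j - β j' i j + β j i' j' - α i i' j' : ℤ) : ℂ)
        = ((if j < j' then 1 else 0 : ℤ) : ℂ) := by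
      apply mul_right_cancel₀ hpi
      push_cast
      rcases lt_or_gt_of_ne hj with h | h
      · have hb := orderedLog_sub b h
        rw [if_pos h]
        linear_combination hsq + ha + hb
      · have hb := orderedLog_sub b h
        rw [if_neg h.not_gt]
        linear_combination hsq + ha - hb
    exact_mod_cast key
  have r := fun i i' (hi : i < i') => And.intro (And.intro (rel i i' 0 1 hi (by decide))
    (rel i i' 1 0 hi (by decide))) (And.intro (And.intro (rel i i' 0 2 hi (by decide))
    (rel i i' 2 0 hi (by decide))) (And.intro (rel i i' 1 2 hi (by decide))
    (rel i i' 2 1 hi (by decide))))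
  have r01 := r 0 1 (by decide)
  have r02 := r 0 2 (by decide)
  have r12 := r 1 2 (by decide)
  simp at r01 r02 r12
  omega

/-- The points of the plane used by a drawing for the subgraph induced on `S`. -/
def PlanarDrawing.image {V : Type} {G : SimpleGraph V} (D : PlanarDrawing G) (S : Set V) :
    Set (ℝ × ℝ) :=
  D.p '' S ∪ {z | ∃ u ∈ S, ∃ v ∈ S, G.Adj u v ∧ ∃ t ∈ Icc (0 : ℝ) 1, D.c u v t = z}

theorem PlanarDrawing.disjoint_image {V : Type} {G : SimpleGraph V} (D : PlanarDrawing G)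
    {S T : Set V} (h : Disjoint S T) : Disjoint (D.image S) (D.image T) := by
  rw [Set.disjoint_left] at h ⊢
  rintro z (⟨u, hu, rfl⟩ | ⟨u, hu, v, hv, huv, s, hs, rfl⟩)
    (⟨x, hx, hz⟩ | ⟨x, hx, y, hy, hxy, t, ht, hz⟩)
  · exact h hu (D.p_inj hz ▸ hx)
  · rcases D.c_vertex x y hxy t ht u hz with rfl | rfl
    exacts [h hu hx, h hu hy]
  · rcases D.c_vertex u v huv s hs x hz.symm with rfl | rfl
    exacts [h hu hx, h hv hx]
  · have hne : ({u, v} : Set V) ≠ {x, y} := fun he => by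
      have : u ∈ ({x, y} : Set V) := he ▸ Set.mem_insert u _
      rcases this with rfl | rfl
      exacts [h hu hx, h hu hy]
    obtain ⟨w, hw, hw', -⟩ := D.c_cross u v x y huv hxy hne s hs t ht hz.symm
    have hS : w ∈ S := by rcases hw with rfl | rfl <;> assumption
    have hT : w ∈ T := by rcases hw' with rfl | rfl <;> assumption
    exact h hS hT

theorem PlanarDrawing.joinedIn_image {V : Type} {G : SimpleGraph V} (D : PlanarDrawing G)
    {S : Set V} (hS : (G.induce S).Connected) {u v : V} (hu : u ∈ S) (hv : v ∈ S) :
    JoinedIn (D.image S) (D.p u) (D.p v) := by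
  have key : ∀ {x y : S}, (G.induce S).Walk x y → JoinedIn (D.image S) (D.p x) (D.p y) := by
    intro x y w
    induction w with
    | nil => exact JoinedIn.refl (Or.inl (mem_image_of_mem _ (Subtype.prop _)))
    | @cons x y z h w ih =>
      have hadj : G.Adj x y := h
      refine JoinedIn.trans (JoinedIn.ofLine (D.c_cont x y hadj) (D.c_start x y hadj)
        (D.c_end x y hadj) ?_) ih
      rintro _ ⟨t, ht, rfl⟩
      exact Or.inr ⟨x, x.2, y, y.2, hadj, t, ht, rfl⟩
  obtain ⟨w⟩ := hS.preconnected ⟨u, hu⟩ ⟨v, hv⟩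
  exact key w

theorem SimpleGraph.induce_singleton_connected {V : Type} (G : SimpleGraph V) (v : V) :
    (G.induce {v}).Connected := by
  have : Nonempty ({v} : Set V) := ⟨⟨v, rfl⟩⟩
  exact ⟨fun x y => by rw [Subsingleton.elim x y]⟩

/-- A planar graph has no minor of the complete bipartite graph on `3 + 3` vertices in which the
three branch sets of one side are single vertices. -/
theorem PlanarDrawing.not_exists_minor {V : Type} {G : SimpleGraph V} (D : PlanarDrawing G)
    (h : Fin 3 → V) (hinj : Function.Injective h) (P : Fin 3 → Set V)
    (hP : ∀ j, (G.induce (P j)).Connected) (hdis : ∀ j j', j ≠ j' → Disjoint (P j) (P j'))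
    (hmem : ∀ i j, h i ∉ P j) (hadj : ∀ i j, ∃ x ∈ P j, G.Adj (h i) x) : False := by
  have hne : ∀ j, ∃ x, x ∈ P j := fun j => ⟨_, (hP j).nonempty.some.2⟩
  choose q hq using hne
  have hconn : ∀ i j, (G.induce ({h i} ∪ P j)).Connected := fun i j => by
    obtain ⟨x, hx, hix⟩ := hadj i j
    exact SimpleGraph.connected_induce_union (G.induce_singleton_connected (h i)).preconnected
      (hP j).preconnected rfl hx hix
  have hjoin : ∀ i j, JoinedIn (D.image ({h i} ∪ P j)) (D.p (h i)) (D.p (q j)) := fun i j =>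
    D.joinedIn_image (hconn i j) (Or.inl rfl) (Or.inr (hq j))
  choose γ hγ using hjoin
  have he := Complex.equivRealProdCLM.symm.continuous
  obtain ⟨i, i', j, j', hi, hj, s, t, hst⟩ := exists_independent_curves_meet
    (fun i => Complex.equivRealProdCLM.symm (D.p (h i)))
    (fun j => Complex.equivRealProdCLM.symm (D.p (q j)))
    (fun i j t => Complex.equivRealProdCLM.symm ((γ i j).extend t))
    (fun i j => he.comp (γ i j).continuous_extend) (by simp) (by simp)
  have hst := Complex.equivRealProdCLM.symm.injective hst
  have himg : ∀ i j t, (γ i j).extend t ∈ D.image ({h i} ∪ P j) := fun i j t => by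
    have : (γ i j).extend t ∈ range (γ i j) := by
      rw [← Path.extend_range]
      exact mem_range_self t
    obtain ⟨x, hx⟩ := this
    exact hx ▸ hγ i j x
  have hd : Disjoint ({h i} ∪ P j) ({h i'} ∪ P j') := by
    rw [Set.disjoint_left]
    rintro x (rfl | hx) (hx' | hx')
    · exact hi (hinj hx')
    · exact hmem i j' hx'
    · exact hmem i' j (hx' ▸ hx)
    · exact Set.disjoint_left.1 (hdis j j' hj) hx hx'
  exact Set.disjoint_left.1 (D.disjoint_image hd) (himg i j s) (hst ▸ himg i' j' t)

/-- Disjoint connected branch sets `B c` for `c ∈ K` and a set `I` of vertices outside of them,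
each vertex `g ∈ I` having a neighbour in the branch sets indexed by the three elements of
`T g`. -/
structure TripodSystem {V : Type} (G : SimpleGraph V) (K I : Finset V) (B : V → Set V)
    (T : V → Finset V) : Prop where
  connected : ∀ c ∈ K, (G.induce (B c)).Connected
  disjoint : ∀ c ∈ K, ∀ d ∈ K, c ≠ d → Disjoint (B c) (B d)
  notMem : ∀ g ∈ I, ∀ c ∈ K, g ∉ B c
  subset : ∀ g ∈ I, T g ⊆ K
  card_eq : ∀ g ∈ I, (T g).card = 3
  adj : ∀ g ∈ I, ∀ c ∈ T g, ∃ x ∈ B c, G.Adj g x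

namespace TripodSystem

variable {V : Type} {G : SimpleGraph V} {K I : Finset V} {B : V → Set V} {T : V → Finset V}

theorem restrict (hs : TripodSystem G K I B T) {K' I' : Finset V} (hK : K' ⊆ K) (hI : I' ⊆ I)
    (hT : ∀ g ∈ I', T g ⊆ K') : TripodSystem G K' I' B T where
  connected c hc := hs.connected c (hK hc)
  disjoint c hc d hd := hs.disjoint c (hK hc) d (hK hd)
  notMem g hg c hc := hs.notMem g (hI hg) c (hK hc)
  subset := hT
  card_eq g hg := hs.card_eq g (hI hg)
  adj g hg := hs.adj g (hI hg)

variable [DecidableEq V]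

/-- Contract the branch sets of `c` and `d` into one along a vertex `h` adjacent to both. -/
theorem contract (hs : TripodSystem G K I B T) {c d h : V} (hcd : c ≠ d) (hh : h ∈ I)
    (hc : c ∈ T h) (hd : d ∈ T h) :
    TripodSystem G (K.erase d) (I.filter fun g => ¬ (c ∈ T g ∧ d ∈ T g))
      (Function.update B c ({h} ∪ B c ∪ B d))
      (fun g => (T g).image fun x => if x = d then c else x) where
  connected e he := by
    obtain ⟨hed, heK⟩ := Finset.mem_erase.1 he
    by_cases hec : e = c
    · subst hec
      rw [Function.update_self]
      obtain ⟨x, hx, hhx⟩ := hs.adj h hh e hc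
      obtain ⟨y, hy, hhy⟩ := hs.adj h hh d hd
      have h1 := SimpleGraph.connected_induce_union
        (G.induce_singleton_connected h).preconnected (hs.connected e heK).preconnected rfl hx hhx
      exact SimpleGraph.connected_induce_union h1.preconnected
        (hs.connected d (hs.subset h hh hd)).preconnected (Or.inl rfl) hy hhy
    · rw [Function.update_of_ne hec]
      exact hs.connected e heK
  disjoint := by
    have key : ∀ e ∈ K.erase d, e ≠ c → Disjoint ({h} ∪ B c ∪ B d) (B e) := by
      intro e he hec
      obtain ⟨hed, heK⟩ := Finset.mem_erase.1 he
      simp only [Set.disjoint_union_left, Set.disjoint_singleton_left]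
      exact ⟨⟨hs.notMem h hh e heK, hs.disjoint c (hs.subset h hh hc) e heK hec.symm⟩,
        hs.disjoint d (hs.subset h hh hd) e heK hed.symm⟩
    intro e he f hf hef
    by_cases hec : e = c
    · subst hec
      rw [Function.update_self, Function.update_of_ne hef.symm]
      exact key f hf hef.symm
    · rw [Function.update_of_ne hec]
      by_cases hfc : f = c
      · subst hfc
        rw [Function.update_self]
        exact (key e he hec).symm
      · rw [Function.update_of_ne hfc]
        exact hs.disjoint e (Finset.mem_of_mem_erase he) f (Finset.mem_of_mem_erase hf) hef
  notMem g hg e he := by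
    obtain ⟨hgI, hg⟩ := Finset.mem_filter.1 hg
    by_cases hec : e = c
    · subst hec
      rw [Function.update_self]
      rintro ((rfl | hx) | hx)
      · exact hg ⟨hc, hd⟩
      · exact hs.notMem g hgI e (hs.subset h hh hc) hx
      · exact hs.notMem g hgI d (hs.subset h hh hd) hx
    · rw [Function.update_of_ne hec]
      exact hs.notMem g hgI e (Finset.mem_of_mem_erase he)
  subset g hg x hx := by
    obtain ⟨hgI, -⟩ := Finset.mem_filter.1 hg
    obtain ⟨y, hy, rfl⟩ := Finset.mem_image.1 hx
    split_ifs with hyd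
    · exact Finset.mem_erase.2 ⟨hcd, hs.subset h hh hc⟩
    · exact Finset.mem_erase.2 ⟨hyd, hs.subset g hgI hy⟩
  card_eq g hg := by
    obtain ⟨hgI, hg⟩ := Finset.mem_filter.1 hg
    rw [Finset.card_image_of_injOn, hs.card_eq g hgI]
    intro x hx y hy hxy
    simp only [Finset.mem_coe] at hx hy
    simp only at hxy
    split_ifs at hxy <;> grind
  adj g hg e he := by
    obtain ⟨hgI, -⟩ := Finset.mem_filter.1 hg
    obtain ⟨y, hy, rfl⟩ := Finset.mem_image.1 he
    obtain ⟨x, hx, hgx⟩ := hs.adj g hgI y hy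
    refine ⟨x, ?_, hgx⟩
    split_ifs with hyd
    · subst hyd
      rw [Function.update_self]
      exact Or.inr hx
    · by_cases hyc : y = c
      · subst hyc
        rw [Function.update_self]
        exact Or.inl (Or.inr hx)
      · rwa [Function.update_of_ne hyc]

/-- If three vertices of `I` are adjacent to the branch sets of both `c` and `d`, then `c` and `d`
separate the system. -/
theorem exists_separation (D : PlanarDrawing G) (hs : TripodSystem G K I B T) {c d : V}
    (hcd : c ≠ d) (hcard : 2 < (I.filter fun g => c ∈ T g ∧ d ∈ T g).card) :
    ∃ L ⊆ (K.erase c).erase d, L.Nonempty ∧ L ≠ (K.erase c).erase d ∧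
      ∀ g ∈ I, ∀ x ∈ T g, ∀ y ∈ T g, x ∈ L → y ∈ (K.erase c).erase d → y ∈ L := by
  classical
  obtain ⟨h₀, h₁, h₂, m₀, m₁, m₂, h₀₁, h₀₂, h₁₂⟩ := Finset.two_lt_card_iff.1 hcard
  have third : ∀ h ∈ I.filter (fun g => c ∈ T g ∧ d ∈ T g),
      ∃ e ∈ (K.erase c).erase d, e ∈ T h := by
    intro h hm
    obtain ⟨hI, hc, hd⟩ := Finset.mem_filter.1 hm
    have : (((T h).erase c).erase d).Nonempty := by
      rw [← Finset.card_pos, Finset.card_erase_of_mem (by simp [hd, hcd.symm]),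
        Finset.card_erase_of_mem hc, hs.card_eq h hI]
      norm_num
    obtain ⟨e, he⟩ := this
    simp only [Finset.mem_erase] at he ⊢
    exact ⟨e, ⟨he.1, he.2.1, hs.subset h hI he.2.2⟩, he.2.2⟩
  obtain ⟨e₀, k₀, t₀⟩ := third h₀ m₀
  obtain ⟨e₁, k₁, t₁⟩ := third h₁ m₁
  obtain ⟨e₂, k₂, t₂⟩ := third h₂ m₂
  have hcK : c ∈ K := by
    obtain ⟨hI, hc, hd⟩ := Finset.mem_filter.1 m₀
    exact hs.subset _ hI hc
  have hdK : d ∈ K := by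
    obtain ⟨hI, hc, hd⟩ := Finset.mem_filter.1 m₀
    exact hs.subset _ hI hd
  have hK : ∀ {e}, e ∈ (K.erase c).erase d → e ≠ d ∧ e ≠ c ∧ e ∈ K := by
    intro e he
    simpa using he
  set Good : Set V → Prop := fun S => (G.induce S).Connected ∧ B e₀ ⊆ S ∧ Disjoint S (B c) ∧
    Disjoint S (B d) ∧ ∀ g ∈ I, c ∈ T g → d ∈ T g → g ∉ S
  set L := ((K.erase c).erase d).filter fun e => ∃ S, Good S ∧ B e ⊆ S with hL
  have he₀ : e₀ ∈ L := by
    obtain ⟨hd, hc, heK⟩ := hK k₀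
    exact Finset.mem_filter.2 ⟨k₀, B e₀, ⟨hs.connected _ heK, subset_rfl,
      hs.disjoint _ heK _ hcK hc, hs.disjoint _ heK _ hdK hd,
      fun g hg _ _ => hs.notMem g hg _ heK⟩, subset_rfl⟩
  have hsub : L ⊆ (K.erase c).erase d := Finset.filter_subset _ _
  refine ⟨L, hsub, ⟨e₀, he₀⟩, fun hLK => ?_, fun g hg x hx y hy hxL hyK => ?_⟩
  · obtain ⟨-, S₁, ⟨s₁, b₁, c₁, d₁, n₁⟩, q₁⟩ := Finset.mem_filter.1 (hLK ▸ k₁ : e₁ ∈ L)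
    obtain ⟨-, S₂, ⟨s₂, b₂, c₂, d₂, n₂⟩, q₂⟩ := Finset.mem_filter.1 (hLK ▸ k₂ : e₂ ∈ L)
    obtain ⟨v, hv⟩ := (hs.connected _ (hK k₀).2.2).nonempty
    obtain ⟨i₀, c₀', d₀'⟩ := Finset.mem_filter.1 m₀
    obtain ⟨i₁, c₁', d₁'⟩ := Finset.mem_filter.1 m₁
    obtain ⟨i₂, c₂', d₂'⟩ := Finset.mem_filter.1 m₂
    have conn := SimpleGraph.induce_union_connected s₁.preconnected s₂.preconnected
      ⟨v, b₁ hv, b₂ hv⟩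
    have dc : Disjoint (S₁ ∪ S₂) (B c) := Set.disjoint_union_left.2 ⟨c₁, c₂⟩
    have dd : Disjoint (S₁ ∪ S₂) (B d) := Set.disjoint_union_left.2 ⟨d₁, d₂⟩
    have hBcd := hs.disjoint c hcK d hdK hcd
    have hn : ∀ g ∈ I, c ∈ T g → d ∈ T g → g ∉ S₁ ∪ S₂ := fun g hg hc hd hu =>
      hu.elim (n₁ g hg hc hd) (n₂ g hg hc hd)
    have ha : ∀ h ∈ I, ∀ e ∈ T h, B e ⊆ S₁ ∪ S₂ → ∃ x ∈ S₁ ∪ S₂, G.Adj h x :=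
      fun h hI e he hB => by
        obtain ⟨x, hx, hhx⟩ := hs.adj h hI e he
        exact ⟨x, hB hx, hhx⟩
    refine D.not_exists_minor ![h₀, h₁, h₂] ?_ ![B c, B d, S₁ ∪ S₂] ?_ ?_ ?_ ?_
    · intro i j hij
      fin_cases i <;> fin_cases j
      exacts [rfl, absurd hij h₀₁, absurd hij h₀₂, absurd hij.symm h₀₁, rfl, absurd hij h₁₂,
        absurd hij.symm h₀₂, absurd hij.symm h₁₂, rfl]
    · intro j
      fin_cases j
      exacts [hs.connected c hcK, hs.connected d hdK, conn]
    · intro j j' hj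
      fin_cases j <;> fin_cases j'
      exacts [absurd rfl hj, hBcd, dc.symm, hBcd.symm, absurd rfl hj, dd.symm, dc, dd,
        absurd rfl hj]
    · intro i j
      fin_cases i <;> fin_cases j
      exacts [hs.notMem _ i₀ _ hcK, hs.notMem _ i₀ _ hdK, hn _ i₀ c₀' d₀',
        hs.notMem _ i₁ _ hcK, hs.notMem _ i₁ _ hdK, hn _ i₁ c₁' d₁',
        hs.notMem _ i₂ _ hcK, hs.notMem _ i₂ _ hdK, hn _ i₂ c₂' d₂']
    · intro i j
      fin_cases i <;> fin_cases j
      exacts [hs.adj _ i₀ _ c₀', hs.adj _ i₀ _ d₀',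
        ha _ i₀ _ t₀ (b₁.trans subset_union_left),
        hs.adj _ i₁ _ c₁', hs.adj _ i₁ _ d₁', ha _ i₁ _ t₁ (q₁.trans subset_union_left),
        hs.adj _ i₂ _ c₂', hs.adj _ i₂ _ d₂', ha _ i₂ _ t₂ (q₂.trans subset_union_right)]
  · by_cases hxy : x = y
    · exact hxy ▸ hxL
    obtain ⟨hxK, S, ⟨s, b, hSc, hSd, n⟩, q⟩ := Finset.mem_filter.1 hxL
    obtain ⟨hxd, hxc, -⟩ := hK hxK
    obtain ⟨hyd, hyc, hyK'⟩ := hK hyK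
    obtain ⟨u, hu, hgu⟩ := hs.adj g hg x hx
    obtain ⟨w, hw, hgw⟩ := hs.adj g hg y hy
    have hgcd : ¬ (c ∈ T g ∧ d ∈ T g) := fun ⟨hc, hd⟩ => by
      have hle : ({x, y, c, d} : Finset V) ⊆ T g := by
        simp [Finset.insert_subset_iff, hx, hy, hc, hd]
      have := Finset.card_le_card hle
      rw [hs.card_eq g hg, Finset.card_insert_of_notMem (by simp [hxy, hxc, hxd]),
        Finset.card_insert_of_notMem (by simp [hyc, hyd]), Finset.card_pair hcd] at this
      omega
    have conn₁ := SimpleGraph.connected_induce_union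
      (G.induce_singleton_connected g).preconnected s.preconnected rfl (q hu) hgu
    have conn := SimpleGraph.connected_induce_union conn₁.preconnected
      (hs.connected y hyK').preconnected (Or.inl rfl) hw hgw
    refine Finset.mem_filter.2 ⟨hyK, _, ⟨conn, ?_, ?_, ?_, ?_⟩, subset_union_right⟩
    · exact b.trans (subset_union_right.trans subset_union_left)
    · simp only [Set.disjoint_union_left, Set.disjoint_singleton_left]
      exact ⟨⟨hs.notMem g hg c hcK, hSc⟩, hs.disjoint y hyK' c hcK hyc⟩
    · simp only [Set.disjoint_union_left, Set.disjoint_singleton_left]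
      exact ⟨⟨hs.notMem g hg d hdK, hSd⟩, hs.disjoint y hyK' d hdK hyd⟩
    · rintro f hf hfc hfd ((rfl | hfS) | hfy)
      · exact hgcd ⟨hfc, hfd⟩
      · exact n f hf hfc hfd hfS
      · exact hs.notMem f hf y hyK' hfy

theorem card_add_four_le (D : PlanarDrawing G) (hs : TripodSystem G K I B T) (hK : 2 ≤ K.card) :
    I.card + 4 ≤ 2 * K.card := by
  induction hm : K.card using Nat.strong_induction_on generalizing K I B T with
  | _ m ih =>
    rcases I.eq_empty_or_nonempty with rfl | ⟨h, hh⟩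
    · simp only [Finset.card_empty]
      omega
    have h3 := hs.card_eq h hh
    obtain ⟨c, hc, d, hd, hcd⟩ := Finset.one_lt_card.1 (by omega : 1 < (T h).card)
    have hcK := hs.subset h hh hc
    have hdK := hs.subset h hh hd
    have hKc : 3 ≤ K.card := h3 ▸ Finset.card_le_card (hs.subset h hh)
    rcases le_or_gt (I.filter fun g => c ∈ T g ∧ d ∈ T g).card 2 with hle | hlt
    · have hcard := Finset.card_erase_of_mem hdK
      have := ih (K.erase d).card (by omega) (hs.contract hcd hh hc hd) (by omega) rfl
      have hsum := Finset.card_filter_add_card_filter_not (s := I)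
        (fun g => c ∈ T g ∧ d ∈ T g)
      omega
    · obtain ⟨L, hLK, hLne, hLK', hL⟩ := hs.exists_separation D hcd hlt
      set K₀ := (K.erase c).erase d with hK₀
      have hK₀K : K₀ ⊆ K := (Finset.erase_subset _ _).trans (Finset.erase_subset _ _)
      have hK₀card : K₀.card + 2 = K.card := by
        rw [hK₀, Finset.card_erase_of_mem (by simp [hdK, hcd.symm]),
          Finset.card_erase_of_mem hcK]
        omega
      have hadd : ∀ M ⊆ K₀, (insert c (insert d M)).card = M.card + 2 := by
        intro M hM
        rw [Finset.card_insert_of_notMem, Finset.card_insert_of_notMem]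
        · exact fun hdM => by simpa [hK₀] using hM hdM
        · simp only [Finset.mem_insert, not_or]
          exact ⟨hcd, fun hcM => by simpa [hK₀] using hM hcM⟩
      have part : ∀ M ⊆ K₀, M.Nonempty → M.card < K₀.card →
          (I.filter fun g => T g ⊆ insert c (insert d M)).card ≤ 2 * M.card := by
        intro M hM hMne hMlt
        have hMpos := hMne.card_pos
        have hMc := hadd M hM
        have := ih (insert c (insert d M)).card (by omega) (hs.restrict
          (I' := I.filter fun g => T g ⊆ insert c (insert d M))
          (by simp [Finset.insert_subset_iff, hcK, hdK, hM.trans hK₀K])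
          (Finset.filter_subset _ _) (fun g hg => (Finset.mem_filter.1 hg).2)) (by omega) rfl
        omega
      have hLlt : L.card < K₀.card := Finset.card_lt_card (hLK.ssubset_of_ne hLK')
      have hLpos := hLne.card_pos
      have hsd := Finset.card_sdiff_add_card_eq_card hLK
      have p₁ := part L hLK hLne hLlt
      have p₂ := part (K₀ \ L) Finset.sdiff_subset (Finset.card_pos.1 (by omega)) (by omega)
      have hcover : I ⊆ (I.filter fun g => T g ⊆ insert c (insert d L)) ∪
          (I.filter fun g => T g ⊆ insert c (insert d (K₀ \ L))) := by
        intro g hg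
        simp only [Finset.mem_union, Finset.mem_filter, hg, true_and]
        have hmem : ∀ y ∈ T g, y = c ∨ y = d ∨ y ∈ K₀ := fun y hy => by
          have := hs.subset g hg hy
          simp only [hK₀, Finset.mem_erase]
          tauto
        by_cases hx : ∃ x ∈ T g, x ∈ L
        · obtain ⟨x, hxT, hxL⟩ := hx
          left
          intro y hy
          simp only [Finset.mem_insert]
          exact (hmem y hy).imp_right (Or.imp_right (hL g hg x hxT y hy hxL))
        · right
          intro y hy
          simp only [Finset.mem_insert, Finset.mem_sdiff]
          exact (hmem y hy).imp_right (Or.imp_right fun hyK => ⟨hyK, fun hyL => hx ⟨y, hy, hyL⟩⟩)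
      have := (Finset.card_le_card hcover).trans (Finset.card_union_le _ _)
      omega

end TripodSystem

/-- In a finite simple planar graph with a vertex cover `C` of size `k`, there are at most
`2·k` vertices outside `C` of degree at least 3. -/
theorem card_high_degree_outside_cover_le {V : Type} [Fintype V] [DecidableEq V]
    (G : SimpleGraph V) [DecidableRel G.Adj] (hG : Nonempty (PlanarDrawing G))
    (C : Finset V) (hC : ∀ u v, G.Adj u v → u ∈ C ∨ v ∈ C) (k : ℕ) (hk : C.card = k) :
    {v : V | v ∉ C ∧ 3 ≤ G.degree v}.ncard ≤ 2 * k := by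
  obtain ⟨D⟩ := hG
  set I : Finset V := Finset.univ.filter fun v => v ∉ C ∧ 3 ≤ G.degree v with hI
  have hset : {v : V | v ∉ C ∧ 3 ≤ G.degree v} = (I : Set V) := by
    ext v
    simp [hI]
  rw [hset, Set.ncard_coe_finset]
  rcases I.eq_empty_or_nonempty with hempty | ⟨g, hg⟩
  · simp [hempty]
  have hT : ∀ v, ∃ t : Finset V, v ∈ I → t ⊆ G.neighborFinset v ∧ t.card = 3 := fun v => by
    by_cases hv : v ∈ I
    · obtain ⟨t, ht⟩ := Finset.exists_subset_card_eq (Finset.mem_filter.1 hv).2.2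
      exact ⟨t, fun _ => ht⟩
    · exact ⟨∅, fun h => absurd h hv⟩
  choose T hT using hT
  have hadj : ∀ v ∈ I, ∀ c ∈ T v, G.Adj v c := fun v hv c hc =>
    (G.mem_neighborFinset v c).1 ((hT v hv).1 hc)
  have hs : TripodSystem G C I (fun c => {c}) T :=
    { connected := fun c _ => G.induce_singleton_connected c
      disjoint := fun c _ d _ hcd => Set.disjoint_singleton.2 hcd
      notMem := fun v hv c hc hvc => (Finset.mem_filter.1 hv).2.1 (hvc ▸ hc)
      subset := fun v hv c hc =>
        (hC v c (hadj v hv c hc)).resolve_left (Finset.mem_filter.1 hv).2.1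
      card_eq := fun v hv => (hT v hv).2
      adj := fun v hv c hc => ⟨c, rfl, hadj v hv c hc⟩ }
  have h3 : 3 ≤ C.card := (hs.card_eq g hg) ▸ Finset.card_le_card (hs.subset g hg)
  have := hs.card_add_four_le D (by omega)
  omega
end

section
/- Let G = (V, E) be a finite simple planar graph and let A ⊆ V. Then the number of connected components of the subgraph of G induced by V ∖ A that are adjacent in G to more than two vertices of A is at most 2·|A|. -/
open Set

theorem exists_continuous_exp_eq {E : Type*} [NormedAddCommGroup E] [NormedSpace ℝ E]
    {F : E → ℂ} (hF : Continuous F) (h0 : ∀ x, F x ≠ 0) :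
    ∃ g : E → ℂ, Continuous g ∧ ∀ x, Complex.exp (g x) = F x := by
  obtain ⟨g, ⟨-, hg⟩, -⟩ := Complex.isCoveringMap_exp.existsUnique_continuousMap_lifts
    (⟨fun x => ⟨F x, h0 x⟩, by fun_prop⟩ : C(E, {z : ℂ // z ≠ 0})) 0 (Complex.log (F 0))
    (Subtype.ext (Complex.exp_log (h0 0)))
  exact ⟨g, g.continuous, fun x => congrArg Subtype.val (congrFun hg x)⟩

theorem sub_eq_sub_of_exp_eq_mul_exp {g h : ℝ → ℂ} (hg : Continuous g) (hh : Continuous h)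
    {c : ℂ} (hgh : ∀ t, Complex.exp (g t) = c * Complex.exp (h t)) :
    g 1 - g 0 = h 1 - h 0 := by
  have key := Complex.isCoveringMap_exp.const_of_comp (g := fun t => g t - h t) (by fun_prop)
    (fun a a' => Subtype.ext (by
      have (t : ℝ) : Complex.exp (g t - h t) = c := by
        rw [Complex.exp_sub, hgh, mul_div_cancel_right₀ _ (Complex.exp_ne_zero _)]
      simp only [this])) 1 0
  linear_combination key

theorem angle_change_square {f g h₁ h₂ h₃ h₄ : ℝ → ℂ} (hf : Continuous f) (hg : Continuous g)
    (hfg : ∀ s t, f s ≠ g t) (hc₁ : Continuous h₁) (hc₂ : Continuous h₂) (hc₃ : Continuous h₃)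
    (hc₄ : Continuous h₄) (he₁ : ∀ s, Complex.exp (h₁ s) = f s - g 0)
    (he₂ : ∀ t, Complex.exp (h₂ t) = g t - f 1) (he₃ : ∀ s, Complex.exp (h₃ s) = f s - g 1)
    (he₄ : ∀ t, Complex.exp (h₄ t) = g t - f 0) :
    (h₁ 1 - h₁ 0) + (h₂ 1 - h₂ 0) = (h₃ 1 - h₃ 0) + (h₄ 1 - h₄ 0) := by
  obtain ⟨H, hH, hexp⟩ := exists_continuous_exp_eq (E := ℝ × ℝ)
    (F := fun z => f z.1 - g z.2) (by fun_prop) (fun z => sub_ne_zero.2 (hfg _ _))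
  have e₁ := sub_eq_sub_of_exp_eq_mul_exp (g := h₁) (h := fun s => H (s, 0)) (c := 1) hc₁
    (by fun_prop) (fun t => by rw [he₁, hexp, one_mul])
  have e₂ := sub_eq_sub_of_exp_eq_mul_exp (g := h₂) (h := fun t => H (1, t)) (c := -1) hc₂
    (by fun_prop) (fun t => by rw [he₂, hexp]; ring)
  have e₃ := sub_eq_sub_of_exp_eq_mul_exp (g := h₃) (h := fun s => H (s, 1)) (c := 1) hc₃
    (by fun_prop) (fun t => by rw [he₃, hexp, one_mul])
  have e₄ := sub_eq_sub_of_exp_eq_mul_exp (g := h₄) (h := fun t => H (0, t)) (c := -1) hc₄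
    (by fun_prop) (fun t => by rw [he₄, hexp]; ring)
  linear_combination e₁ + e₂ - e₃ - e₄

/-- A choice of logarithms of the differences of three distinct points. -/
theorem exists_log_differences {x : Fin 3 → ℂ} (hx : ∀ i k, i ≠ k → x i ≠ x k) :
    ∃ d : Fin 3 → Fin 3 → ℂ, (∀ i k, i ≠ k → Complex.exp (d i k) = x k - x i) ∧
      ∀ i k, i < k → d k i = d i k + Real.pi * Complex.I := by
  refine ⟨fun i k => if i < k then Complex.log (x k - x i)
    else Complex.log (x i - x k) + Real.pi * Complex.I, fun i k hik => ?_, fun i k hik => ?_⟩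
  · dsimp only
    split_ifs
    · exact Complex.exp_log (sub_ne_zero.2 (hx _ _ hik.symm))
    · rw [Complex.exp_add, Complex.exp_pi_mul_I, Complex.exp_log (sub_ne_zero.2 (hx _ _ hik))]
      ring
  · simp [hik, hik.not_gt]

theorem parity_contradiction {n m : Fin 3 → Fin 3 → Fin 3 → ℤ}
    (h : ∀ i k j l, i < k → j ≠ l →
      n k i j + m j k l - m l i j - n i k l = if j < l then 1 else 0) : False := by
  have e : ∀ i k, i < k → _ := fun i k hik =>
    And.intro (h i k 0 1 hik (by decide)) <| And.intro (h i k 1 0 hik (by decide)) <|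
    And.intro (h i k 0 2 hik (by decide)) <| And.intro (h i k 2 0 hik (by decide)) <|
    And.intro (h i k 1 2 hik (by decide)) (h i k 2 1 hik (by decide))
  have h₁ := e 0 1 (by decide)
  have h₂ := e 0 2 (by decide)
  have h₃ := e 1 2 (by decide)
  simp at h₁ h₂ h₃
  omega

/-- The complete bipartite graph on three plus three points cannot be mapped continuously to the
plane so that the images of independent edges are disjoint. -/
theorem not_exists_planar_threeByThree {x y : Fin 3 → ℂ} {γ : Fin 3 → Fin 3 → ℝ → ℂ}
    (hγ : ∀ i j, Continuous (γ i j)) (h0 : ∀ i j, γ i j 0 = x i) (h1 : ∀ i j, γ i j 1 = y j)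
    (hd : ∀ i j k l, i ≠ k → j ≠ l → ∀ s t, γ i j s ≠ γ k l t) : False := by
  have ex : ∀ i : Fin 3, ∃ k, k ≠ i := by decide
  have hx : ∀ i k, i ≠ k → x i ≠ x k := fun i k hik => by
    simpa [h0] using hd i 0 k 1 hik (by decide) 0 0
  have hy : ∀ j l, j ≠ l → y j ≠ y l := fun j l hjl => by
    simpa [h1] using hd 0 j 1 l (by decide) hjl 1 1
  have hA : ∀ k i j, ∃ g : ℝ → ℂ, k ≠ i →
      Continuous g ∧ ∀ t, Complex.exp (g t) = γ i j t - x k := by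
    intro k i j
    by_cases hki : k = i
    · exact ⟨0, fun h => (h hki).elim⟩
    obtain ⟨l, hl⟩ := ex j
    obtain ⟨g, hg⟩ := exists_continuous_exp_eq (F := fun t => γ i j t - x k)
      (by have := hγ i j; fun_prop)
      (fun t => sub_ne_zero.2 (by simpa [h0] using hd i j k l (Ne.symm hki) hl.symm t 0))
    exact ⟨g, fun _ => hg⟩
  have hB : ∀ l i j, ∃ g : ℝ → ℂ, l ≠ j →
      Continuous g ∧ ∀ t, Complex.exp (g t) = γ i j t - y l := by
    intro l i j
    by_cases hlj : l = j
    · exact ⟨0, fun h => (h hlj).elim⟩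
    obtain ⟨k, hk⟩ := ex i
    obtain ⟨g, hg⟩ := exists_continuous_exp_eq (F := fun t => γ i j t - y l)
      (by have := hγ i j; fun_prop)
      (fun t => sub_ne_zero.2 (by simpa [h1] using hd i j k l hk.symm (Ne.symm hlj) t 1))
    exact ⟨g, fun _ => hg⟩
  choose A hA using hA
  choose B hB using hB
  obtain ⟨d, hd1, hd2⟩ := exists_log_differences hx
  obtain ⟨e, he1, he2⟩ := exists_log_differences hy
  have hc : ∀ i j, ∃ c : ℂ, Complex.exp c = y j - x i := by
    intro i j
    obtain ⟨k, hk⟩ := ex i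
    obtain ⟨l, hl⟩ := ex j
    have := hd k j i l hk hl.symm 1 0
    rw [h0, h1] at this
    exact ⟨_, Complex.exp_log (sub_ne_zero.2 this)⟩
  choose c hc using hc
  have hn : ∀ k i j, ∃ n : ℤ, k ≠ i →
      A k i j 1 - A k i j 0 = c k j - d k i + n * (2 * Real.pi * Complex.I) := by
    intro k i j
    by_cases hki : k = i
    · exact ⟨0, fun h => (h hki).elim⟩
    have : Complex.exp (A k i j 1 - A k i j 0) = Complex.exp (c k j - d k i) := by
      rw [Complex.exp_sub, Complex.exp_sub, (hA k i j hki).2, (hA k i j hki).2, h1, h0, hc,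
        hd1 k i hki]
    obtain ⟨n, hn⟩ := Complex.exp_eq_exp_iff_exists_int.1 this
    exact ⟨n, fun _ => hn⟩
  have hm : ∀ l i j, ∃ m : ℤ, l ≠ j → B l i j 1 - B l i j 0 =
      e l j - (c i l + Real.pi * Complex.I) + m * (2 * Real.pi * Complex.I) := by
    intro l i j
    by_cases hlj : l = j
    · exact ⟨0, fun h => (h hlj).elim⟩
    have : Complex.exp (B l i j 1 - B l i j 0) =
        Complex.exp (e l j - (c i l + Real.pi * Complex.I)) := by
      rw [Complex.exp_sub, Complex.exp_sub, (hB l i j hlj).2, (hB l i j hlj).2, h1, h0,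
        Complex.exp_add, hc, he1 l j hlj, Complex.exp_pi_mul_I]
      congr 1
      ring
    obtain ⟨m, hm⟩ := Complex.exp_eq_exp_iff_exists_int.1 this
    exact ⟨m, fun _ => hm⟩
  choose n hn using hn
  choose m hm using hm
  refine parity_contradiction (n := n) (m := m) fun i k j l hik hjl => ?_
  have sq := angle_change_square (hγ i j) (hγ k l) (hd i j k l hik.ne hjl)
    (hA k i j hik.ne').1 (hB j k l hjl).1 (hB l i j hjl.symm).1 (hA i k l hik.ne).1
    (by simpa [h0] using (hA k i j hik.ne').2) (by simpa [h1] using (hB j k l hjl).2)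
    (by simpa [h1] using (hB l i j hjl.symm).2) (by simpa [h0] using (hA i k l hik.ne).2)
  rw [hn k i j hik.ne', hm j k l hjl, hm l i j hjl.symm, hn i k l hik.ne, hd2 i k hik] at sq
  have hpi : (2 * Real.pi * Complex.I : ℂ) ≠ 0 := Complex.two_pi_I_ne_zero
  have : ((n k i j + m j k l - m l i j - n i k l : ℤ) : ℂ) =
      ((if j < l then 1 else 0 : ℤ) : ℂ) := by
    apply mul_right_cancel₀ hpi
    split_ifs with hlt
    · rw [he2 j l hlt] at sq
      push_cast
      linear_combination sq
    · rw [he2 l j (lt_of_le_of_ne (not_lt.1 hlt) hjl.symm)] at sq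
      push_cast
      linear_combination sq
  exact_mod_cast this

/-- Reachability in `G` along a walk all of whose vertices lie in `S`. -/
inductive ReachableWithin {V : Type*} (G : SimpleGraph V) (S : Set V) : V → V → Prop
  | refl {u : V} (hu : u ∈ S) : ReachableWithin G S u u
  | step {u v w : V} (h : ReachableWithin G S u v) (hvw : G.Adj v w) (hw : w ∈ S) :
    ReachableWithin G S u w

namespace ReachableWithin

variable {V : Type*} {G : SimpleGraph V} {S T : Set V} {u v w : V}

theorem mem_right (h : ReachableWithin G S u v) : v ∈ S := by
  cases h <;> assumption

theorem mem_left (h : ReachableWithin G S u v) : u ∈ S := by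
  induction h <;> assumption

theorem mono (hST : S ⊆ T) (h : ReachableWithin G S u v) : ReachableWithin G T u v := by
  induction h with
  | refl hu => exact .refl (hST hu)
  | step _ hvw hw ih => exact .step ih hvw (hST hw)

theorem trans (h : ReachableWithin G S u v) (h' : ReachableWithin G S v w) :
    ReachableWithin G S u w := by
  induction h' with
  | refl _ => exact h
  | step _ hvw hw ih => exact .step ih hvw hw

theorem of_adj (hu : u ∈ S) (hv : v ∈ S) (h : G.Adj u v) : ReachableWithin G S u v :=
  .step (.refl hu) h hv

theorem symm (h : ReachableWithin G S u v) : ReachableWithin G S v u := by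
  induction h with
  | refl hu => exact .refl hu
  | step h hvw hw ih => exact (of_adj hw h.mem_right hvw.symm).trans ih

end ReachableWithin

/-- A set of vertices any two of which are joined by a walk inside the set. -/
def IsConnectedWithin {V : Type*} (G : SimpleGraph V) (S : Set V) : Prop :=
  ∀ u ∈ S, ∀ v ∈ S, ReachableWithin G S u v

/-- `G` has six branch sets forming a complete bipartite minor on three plus three vertices. -/
def HasThreeByThreeMinor {V : Type*} (G : SimpleGraph V) : Prop :=
  ∃ X Y : Fin 3 → Set V, (∀ i, IsConnectedWithin G (X i)) ∧ (∀ j, IsConnectedWithin G (Y j)) ∧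
    (∀ i k, i ≠ k → Disjoint (X i) (X k)) ∧ (∀ j l, j ≠ l → Disjoint (Y j) (Y l)) ∧
    (∀ i j, Disjoint (X i) (Y j)) ∧ ∀ i j, ∃ u ∈ X i, ∃ v ∈ Y j, G.Adj u v

namespace PlanarDrawing

variable {V : Type} {G : SimpleGraph V} (D : PlanarDrawing G)

/-- The part of the plane occupied by the subgraph induced on `S`. -/
def region (S : Set V) : Set (ℝ × ℝ) :=
  D.p '' S ∪ {z | ∃ u ∈ S, ∃ v ∈ S, G.Adj u v ∧ ∃ t ∈ Icc (0 : ℝ) 1, D.c u v t = z}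

theorem disjoint_region {S T : Set V} (h : Disjoint S T) :
    Disjoint (D.region S) (D.region T) := by
  rw [Set.disjoint_left] at h ⊢
  rintro z (⟨u, hu, rfl⟩ | ⟨u, hu, v, hv, huv, s, hs, rfl⟩)
    (⟨x, hx, hxz⟩ | ⟨x, hx, y, hy, hxy, t, ht, hxz⟩)
  · exact h hu (D.p_inj hxz ▸ hx)
  · rcases D.c_vertex x y hxy t ht u hxz with rfl | rfl
    exacts [h hu hx, h hu hy]
  · rcases D.c_vertex u v huv s hs x hxz.symm with rfl | rfl
    exacts [h hu hx, h hv hx]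
  · have hne : ({u, v} : Set V) ≠ {x, y} := fun he => by
      have : u ∈ ({x, y} : Set V) := he ▸ Set.mem_insert u {v}
      rcases this with rfl | rfl
      exacts [h hu hx, h hu hy]
    obtain ⟨w, hw, hw', -⟩ := D.c_cross u v x y huv hxy hne s hs t ht hxz.symm
    have hwS : w ∈ S := by rcases hw with rfl | rfl <;> assumption
    have hwT : w ∈ T := by rcases hw' with rfl | rfl <;> assumption
    exact h hwS hwT

theorem joinedIn_region {S : Set V} {u v : V} (h : ReachableWithin G S u v) :
    JoinedIn (D.region S) (D.p u) (D.p v) := by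
  induction h with
  | refl hu => exact .refl (Or.inl ⟨_, hu, rfl⟩)
  | @step v w h hvw hw ih =>
    refine ih.trans (JoinedIn.ofLine (D.c_cont v w hvw) (D.c_start v w hvw) (D.c_end v w hvw) ?_)
    rintro _ ⟨t, ht, rfl⟩
    exact Or.inr ⟨v, h.mem_right, w, hw, hvw, t, ht, rfl⟩

theorem not_hasThreeByThreeMinor (D : PlanarDrawing G) : ¬ HasThreeByThreeMinor G := by
  rintro ⟨X, Y, hX, hY, hXX, hYY, hXY, hadj⟩
  have hXne : ∀ i, ∃ u, u ∈ X i := fun i => (hadj i 0).imp fun _ h => h.1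
  have hYne : ∀ j, ∃ v, v ∈ Y j := fun j => by
    obtain ⟨-, -, v, hv, -⟩ := hadj 0 j
    exact ⟨v, hv⟩
  choose a ha using hXne
  choose b hb using hYne
  have hjoin : ∀ i j, JoinedIn (D.region (X i ∪ Y j)) (D.p (a i)) (D.p (b j)) := by
    intro i j
    obtain ⟨u, hu, v, hv, huv⟩ := hadj i j
    have huv' : ReachableWithin G (X i ∪ Y j) u v := .of_adj (Or.inl hu) (Or.inr hv) huv
    exact D.joinedIn_region <| ((hX i _ (ha i) u hu).mono subset_union_left).trans <|
      huv'.trans <| (hY j v hv _ (hb j)).mono subset_union_right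
  let φ := Complex.equivRealProdCLM.symm
  refine not_exists_planar_threeByThree (x := fun i => φ (D.p (a i)))
    (y := fun j => φ (D.p (b j))) (γ := fun i j t => φ ((hjoin i j).somePath.extend t))
    (fun i j => φ.continuous.comp (hjoin i j).somePath.continuous_extend)
    (fun i j => by simp) (fun i j => by simp) fun i j k l hik hjl s t hst => ?_
  have hdis : Disjoint (X i ∪ Y j) (X k ∪ Y l) := by
    simp only [Set.disjoint_union_left, Set.disjoint_union_right]
    exact ⟨⟨hXX i k hik, (hXY k j).symm⟩, hXY i l, hYY j l hjl⟩
  refine Set.disjoint_left.1 (D.disjoint_region hdis) ((hjoin i j).somePath_mem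
    (Set.projIcc 0 1 zero_le_one s)) ?_
  have heq : (hjoin i j).somePath (Set.projIcc 0 1 zero_le_one s) =
      (hjoin k l).somePath (Set.projIcc 0 1 zero_le_one t) := φ.injective hst
  rw [heq]
  exact (hjoin k l).somePath_mem _

end PlanarDrawing

/-- Disjoint connected branch sets `P a`, `a ∈ 𝒜`, and `Q b`, `b ∈ ℬ`, where each `Q b` is
adjacent to the three branch sets `P a` with `a ∈ N b`. -/
structure TripleModel {V ι κ : Type*} (G : SimpleGraph V) (P : ι → Set V) (Q : κ → Set V)
    (N : κ → Finset ι) (𝒜 : Finset ι) (ℬ : Finset κ) : Prop where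
  nonempty_left : ∀ a ∈ 𝒜, (P a).Nonempty
  conn_left : ∀ a ∈ 𝒜, IsConnectedWithin G (P a)
  conn_right : ∀ b ∈ ℬ, IsConnectedWithin G (Q b)
  disj_left : ∀ a ∈ 𝒜, ∀ a' ∈ 𝒜, a ≠ a' → Disjoint (P a) (P a')
  disj_right : ∀ b ∈ ℬ, ∀ b' ∈ ℬ, b ≠ b' → Disjoint (Q b) (Q b')
  disj : ∀ a ∈ 𝒜, ∀ b ∈ ℬ, Disjoint (P a) (Q b)
  subset : ∀ b ∈ ℬ, N b ⊆ 𝒜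
  card : ∀ b ∈ ℬ, (N b).card = 3
  adj : ∀ b ∈ ℬ, ∀ a ∈ N b, ∃ u ∈ P a, ∃ v ∈ Q b, G.Adj u v

namespace TripleModel

variable {V ι κ : Type*} {G : SimpleGraph V} {P : ι → Set V} {Q : κ → Set V}
  {N : κ → Finset ι} {𝒜 : Finset ι} {ℬ : Finset κ}

/-- The union of two branch sets and a third branch set adjacent to both is connected
within itself. -/
theorem isConnectedWithin_union (M : TripleModel G P Q N 𝒜 ℬ) {a a' : ι} {b : κ} (hb : b ∈ ℬ)
    (ha : a ∈ N b) (ha' : a' ∈ N b) : IsConnectedWithin G (P a ∪ Q b ∪ P a') := by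
  obtain ⟨u, hu, v, hv, huv⟩ := M.adj b hb a ha
  obtain ⟨u', hu', v', hv', huv'⟩ := M.adj b hb a' ha'
  have hQ : ∀ z ∈ Q b, ReachableWithin G (P a ∪ Q b ∪ P a') z v := fun z hz =>
    (M.conn_right b hb z hz v hv).mono fun _ h => Or.inl (Or.inr h)
  have key : ∀ z ∈ P a ∪ Q b ∪ P a', ReachableWithin G (P a ∪ Q b ∪ P a') z v := by
    rintro z ((hz | hz) | hz)
    · exact ((M.conn_left a (M.subset b hb ha) z hz u hu).mono fun _ h => Or.inl (Or.inl h)).trans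
        (.of_adj (Or.inl (Or.inl hu)) (Or.inl (Or.inr hv)) huv)
    · exact hQ z hz
    · exact ((M.conn_left a' (M.subset b hb ha') z hz u' hu').mono fun _ h => Or.inr h).trans
        ((ReachableWithin.of_adj (S := P a ∪ Q b ∪ P a') (Or.inr hu') (Or.inl (Or.inr hv'))
          huv').trans (hQ v' hv'))
  exact fun z hz w hw => (key z hz).trans (key w hw).symm

/-- Contracting `P a`, `Q b` and `P a'` to a single branch set. -/
theorem contract [DecidableEq ι] (M : TripleModel G P Q N 𝒜 ℬ) {a a' : ι} {b : κ} (hb : b ∈ ℬ)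
    (ha : a ∈ N b) (ha' : a' ∈ N b) (hne : a ≠ a') :
    TripleModel G (Function.update P a (P a ∪ Q b ∪ P a')) Q
      (fun c => (N c).image fun z => if z = a' then a else z) (𝒜.erase a')
      (ℬ.filter fun c => ¬ (a ∈ N c ∧ a' ∈ N c)) := by
  have ha𝒜 := M.subset b hb ha
  have ha'𝒜 := M.subset b hb ha'
  have hcb : ∀ c ∈ ℬ.filter fun c => ¬ (a ∈ N c ∧ a' ∈ N c), c ∈ ℬ ∧ c ≠ b := by
    intro c hc
    rw [Finset.mem_filter] at hc
    exact ⟨hc.1, fun h => hc.2 (h ▸ ⟨ha, ha'⟩)⟩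
  have hsub : ∀ z, P z ⊆ Function.update P a (P a ∪ Q b ∪ P a') z := by
    intro z
    rcases eq_or_ne z a with rfl | hz
    · rw [Function.update_self]
      exact fun _ h => Or.inl (Or.inl h)
    · rw [Function.update_of_ne hz]
  have hdis : ∀ z ∈ 𝒜.erase a', z ≠ a → Disjoint (P a ∪ Q b ∪ P a') (P z) := by
    intro z hz hza
    rw [Finset.mem_erase] at hz
    simp only [Set.disjoint_union_left]
    exact ⟨⟨M.disj_left _ ha𝒜 _ hz.2 hza.symm, (M.disj _ hz.2 _ hb).symm⟩,
      M.disj_left _ ha'𝒜 _ hz.2 hz.1.symm⟩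
  refine ⟨?_, ?_, ?_, ?_, ?_, ?_, ?_, ?_, ?_⟩
  · exact fun z hz => (M.nonempty_left z (Finset.mem_of_mem_erase hz)).mono (hsub z)
  · intro z hz
    rcases eq_or_ne z a with rfl | hza
    · rw [Function.update_self]
      exact M.isConnectedWithin_union hb ha ha'
    · rw [Function.update_of_ne hza]
      exact M.conn_left z (Finset.mem_of_mem_erase hz)
  · exact fun c hc => M.conn_right c (hcb c hc).1
  · intro z hz w hw hzw
    rcases eq_or_ne z a with rfl | hza
    · rw [Function.update_self, Function.update_of_ne hzw.symm]
      exact hdis w hw hzw.symm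
    rcases eq_or_ne w a with rfl | hwa
    · rw [Function.update_self, Function.update_of_ne hzw]
      exact (hdis z hz hzw).symm
    rw [Function.update_of_ne hza, Function.update_of_ne hwa]
    exact M.disj_left z (Finset.mem_of_mem_erase hz) w (Finset.mem_of_mem_erase hw) hzw
  · exact fun c hc d hd => M.disj_right c (hcb c hc).1 d (hcb d hd).1
  · intro z hz c hc
    obtain ⟨hcℬ, hne'⟩ := hcb c hc
    rcases eq_or_ne z a with rfl | hza
    · rw [Function.update_self]
      simp only [Set.disjoint_union_left]
      exact ⟨⟨M.disj _ ha𝒜 _ hcℬ, M.disj_right _ hb _ hcℬ hne'.symm⟩, M.disj _ ha'𝒜 _ hcℬ⟩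
    · rw [Function.update_of_ne hza]
      exact M.disj z (Finset.mem_of_mem_erase hz) c hcℬ
  · intro c hc z hz
    obtain ⟨w, hw, rfl⟩ := Finset.mem_image.1 hz
    have := M.subset c (hcb c hc).1 hw
    split_ifs with h
    exacts [Finset.mem_erase.2 ⟨hne, ha𝒜⟩, Finset.mem_erase.2 ⟨h, this⟩]
  · intro c hc
    have hac := (Finset.mem_filter.1 hc).2
    rw [Finset.card_image_of_injOn, M.card c (hcb c hc).1]
    intro z hz w hw hzw
    simp only [Finset.mem_coe] at hz hw
    grind
  · intro c hc z hz
    obtain ⟨w, hw, rfl⟩ := Finset.mem_image.1 hz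
    obtain ⟨u, hu, v, hv, huv⟩ := M.adj c (hcb c hc).1 w hw
    refine ⟨u, ?_, v, hv, huv⟩
    split_ifs with h
    · rw [Function.update_self]
      exact Or.inr (h ▸ hu)
    · exact hsub w hu

/-- Two members of `𝒜` other than the hub `h` that lie with `h` in a common triple. -/
def Link (N : κ → Finset ι) (ℬ : Finset κ) (h u v : ι) : Prop :=
  u ≠ v ∧ u ≠ h ∧ v ≠ h ∧ ∃ b ∈ ℬ, h ∈ N b ∧ u ∈ N b ∧ v ∈ N b

theorem Link.symm {h u v : ι} (H : Link N ℬ h u v) : Link N ℬ h v u := by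
  obtain ⟨h1, h2, h3, b, h4, h5, h6, h7⟩ := H
  exact ⟨h1.symm, h3, h2, b, h4, h5, h7, h6⟩

/-- The union of the branch sets with indices in `s` and `B`. -/
def branchUnion (P : ι → Set V) (Q : κ → Set V) (s : Set ι) (B : Set κ) : Set V :=
  (⋃ z ∈ s, P z) ∪ ⋃ b ∈ B, Q b

theorem disjoint_branchUnion (M : TripleModel G P Q N 𝒜 ℬ) {s s' : Set ι} {B B' : Set κ}
    (hs : s ⊆ 𝒜) (hs' : s' ⊆ 𝒜) (hB : B ⊆ ℬ) (hB' : B' ⊆ ℬ) (hss : Disjoint s s')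
    (hBB : Disjoint B B') : Disjoint (branchUnion P Q s B) (branchUnion P Q s' B') := by
  simp only [branchUnion, Set.disjoint_union_left, Set.disjoint_union_right,
    Set.disjoint_iUnion_left, Set.disjoint_iUnion_right]
  exact ⟨fun z hz => ⟨fun w hw => M.disj_left _ (hs hw) _ (hs' hz) (hss.ne_of_mem hw hz),
    fun c hc => (M.disj _ (hs' hz) _ (hB hc)).symm⟩, fun c hc =>
    ⟨fun z hz => M.disj _ (hs hz) _ (hB' hc),
      fun d hd => M.disj_right _ (hB hd) _ (hB' hc) (hBB.ne_of_mem hd hc)⟩⟩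

theorem exists_third (M : TripleModel G P Q N 𝒜 ℬ) {b : κ} (hb : b ∈ ℬ) (h y : ι) :
    ∃ z ∈ N b, z ≠ h ∧ z ≠ y := by
  classical
  by_contra! hcon
  have : N b ⊆ {h, y} := fun z hz => by
    rw [Finset.mem_insert, Finset.mem_singleton]
    exact or_iff_not_imp_left.2 (hcon z hz)
  have := (Finset.card_le_card this).trans Finset.card_le_two
  rw [M.card b hb] at this
  omega

theorem eq_or_eq_or_eq_of_mem (M : TripleModel G P Q N 𝒜 ℬ) {b : κ} (hb : b ∈ ℬ) {h u v z : ι}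
    (hh : h ∈ N b) (hu : u ∈ N b) (hv : v ∈ N b) (huv : u ≠ v) (huh : u ≠ h) (hvh : v ≠ h)
    (hz : z ∈ N b) : z = h ∨ z = u ∨ z = v := by
  classical
  have hsub : {h, u, v} ⊆ N b := by
    intro w hw
    simp only [Finset.mem_insert, Finset.mem_singleton] at hw
    rcases hw with rfl | rfl | rfl <;> assumption
  have hcard : ({h, u, v} : Finset ι).card = 3 := Finset.card_eq_three.2
    ⟨h, u, v, huh.symm, hvh.symm, huv, rfl⟩
  have := Finset.eq_of_subset_of_card_le hsub (by rw [hcard, M.card b hb])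
  rw [← this] at hz
  simpa using hz

/-- The index `b` together with the indices of the triples containing the hub `h` whose other
elements are `y` or in `l`. -/
def arm (N : κ → Finset ι) (ℬ : Finset κ) (h y : ι) (l : List ι) (b : κ) : Set κ :=
  {c | c = b ∨ c ∈ ℬ ∧ h ∈ N c ∧ ∀ z ∈ N c, z = h ∨ z = y ∨ z ∈ l}

theorem isConnectedWithin_arm (M : TripleModel G P Q N 𝒜 ℬ) {h y : ι} {l : List ι} {b : κ}
    (hb : b ∈ ℬ) (hl : ∀ z ∈ l, z ∈ 𝒜) (hchain : l.IsChain (Link N ℬ h))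
    (hbl : (∃ z ∈ N b, z ∈ l) ∨ l = []) :
    IsConnectedWithin G (branchUnion P Q {z | z ∈ l} (arm N ℬ h y l b)) := by
  set U := branchUnion P Q {z | z ∈ l} (arm N ℬ h y l b) with hU
  have hPU : ∀ z ∈ l, P z ⊆ U := fun z hz p hp => Or.inl (Set.mem_biUnion (x := z) hz hp)
  have hQU : ∀ c ∈ arm N ℬ h y l b, Q c ⊆ U := fun c hc p hp => Or.inr (Set.mem_biUnion hc hp)
  have harm : ∀ c ∈ arm N ℬ h y l b, c ∈ ℬ := by
    rintro c (rfl | hc)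
    exacts [hb, hc.1]
  rcases hbl with ⟨z₀, hz₀, hz₀l⟩ | rfl
  · have hattach : ∀ c ∈ arm N ℬ h y l b, ∃ z ∈ N c, z ∈ l := by
      rintro c (rfl | ⟨hc, -, hcl⟩)
      · exact ⟨z₀, hz₀, hz₀l⟩
      · obtain ⟨z, hz, hzh, hzy⟩ := M.exists_third hc h y
        exact ⟨z, hz, ((hcl z hz).resolve_left hzh).resolve_left hzy⟩
    have hQ : ∀ c ∈ arm N ℬ h y l b, ∀ z ∈ N c, z ∈ l → ∀ p ∈ Q c, ∀ q ∈ P z,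
        ReachableWithin G U p q := by
      intro c hc z hz hzl p hp q hq
      obtain ⟨u, hu, v, hv, huv⟩ := M.adj c (harm c hc) z hz
      exact ((M.conn_right c (harm c hc) p hp v hv).mono (hQU c hc)).trans <|
        (ReachableWithin.of_adj (hQU c hc hv) (hPU z hzl hu) huv.symm).trans <|
        (M.conn_left z (hl z hzl) u hu q hq).mono (hPU z hzl)
    let r : ι → ι → Prop := fun u v => u ∈ 𝒜 ∧ v ∈ 𝒜 ∧ ∀ p ∈ P u, ∀ q ∈ P v,
      ReachableWithin G U p q
    have : Std.Symm r := ⟨fun u v H => ⟨H.2.1, H.1, fun p hp q hq => (H.2.2 q hq p hp).symm⟩⟩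
    have : IsTrans ι r := ⟨fun u v w H H' => by
      obtain ⟨m, hm⟩ := M.nonempty_left v H.2.1
      exact ⟨H.1, H'.2.1, fun p hp q hq => (H.2.2 p hp m hm).trans (H'.2.2 m hm q hq)⟩⟩
    have hrchain : l.IsChain r := hchain.imp_of_mem_imp fun u v hu hv ⟨huv, huh, hvh, c, hc, hhc,
        huc, hvc⟩ => by
      have hcarm : c ∈ arm N ℬ h y l b := Or.inr ⟨hc, hhc, fun z hz => by
        rcases M.eq_or_eq_or_eq_of_mem hc hhc huc hvc huv huh hvh hz with h | rfl | rfl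
        exacts [Or.inl h, Or.inr (Or.inr hu), Or.inr (Or.inr hv)]⟩
      obtain ⟨s, hs, t, ht, -⟩ := M.adj c hc u huc
      exact ⟨hl u hu, hl v hv, fun p hp q hq =>
        (hQ c hcarm u huc hu t ht p hp).symm.trans (hQ c hcarm v hvc hv t ht q hq)⟩
    have hpair : ∀ u ∈ l, ∀ v ∈ l, ∀ p ∈ P u, ∀ q ∈ P v, ReachableWithin G U p q := by
      intro u hu v hv p hp q hq
      rcases eq_or_ne u v with rfl | huv
      · exact (M.conn_left u (hl u hu) p hp q hq).mono (hPU u hu)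
      · exact ((List.isChain_iff_pairwise.1 hrchain).forall hu hv huv).2.2
          p hp q hq
    obtain ⟨m, hm⟩ := M.nonempty_left z₀ (hl z₀ hz₀l)
    have key : ∀ p ∈ U, ReachableWithin G U p m := by
      rintro p (hp | hp)
      · obtain ⟨z, hz, hp⟩ := Set.mem_iUnion₂.1 hp
        exact hpair z hz z₀ hz₀l p hp m hm
      · obtain ⟨c, hc, hp⟩ := Set.mem_iUnion₂.1 hp
        obtain ⟨z, hz, hzl⟩ := hattach c hc
        obtain ⟨q, hq⟩ := M.nonempty_left z (hl z hzl)
        exact (hQ c hc z hz hzl p hp q hq).trans (hpair z hzl z₀ hz₀l q hq m hm)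
    exact fun p hp q hq => (key p hp).trans (key q hq).symm
  · have harm' : ∀ c ∈ arm N ℬ h y [] b, c = b := by
      rintro c (rfl | ⟨hc, -, hcl⟩)
      · rfl
      · obtain ⟨z, hz, hzh, hzy⟩ := M.exists_third hc h y
        rcases hcl z hz with hz | hz | hz
        exacts [(hzh hz).elim, (hzy hz).elim, by simp at hz]
    have key : ∀ p ∈ U, p ∈ Q b := by
      rintro p (hp | hp)
      · simp at hp
      · obtain ⟨c, hc, hp⟩ := Set.mem_iUnion₂.1 hp
        exact harm' c hc ▸ hp
    exact fun p hp q hq => (M.conn_right b hb p (key p hp) q (key q hq)).mono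
      (hQU b (Or.inl rfl))

/-- Three arms between `x` and `y`, all adjacent to the hub `h`, yield a minor. -/
theorem hasThreeByThreeMinor_of_arms (M : TripleModel G P Q N 𝒜 ℬ) {h x y : ι}
    (hh : h ∈ 𝒜) (hx : x ∈ 𝒜) (hy : y ∈ 𝒜) (hxh : x ≠ h) (hyh : y ≠ h) (hxy : x ≠ y)
    (l : Fin 3 → List ι) (b : Fin 3 → κ) (hl : ∀ i, ∀ z ∈ l i, z ∈ 𝒜 ∧ z ≠ h ∧ z ≠ x ∧ z ≠ y)
    (hll : ∀ i j, i ≠ j → ∀ z ∈ l i, z ∉ l j) (hbb : ∀ i j, i ≠ j → b i ≠ b j)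
    (hb : ∀ i, b i ∈ ℬ ∧ h ∈ N (b i) ∧ x ∈ N (b i))
    (hchain : ∀ i, (l i ++ [y]).IsChain (Link N ℬ h))
    (hbl : ∀ i, (∃ z ∈ N (b i), z ∈ l i) ∨ l i = [] ∧ y ∈ N (b i)) :
    HasThreeByThreeMinor G := by
  have harm : ∀ i, arm N ℬ h y (l i) (b i) ⊆ ℬ := by
    rintro i c (rfl | hc)
    exacts [(hb i).1, hc.1]
  have hv : ∀ i, ![h, x, y] i ∈ 𝒜 := by
    intro i; fin_cases i <;> assumption
  refine ⟨fun i => P (![h, x, y] i),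
    fun i => branchUnion P Q {z | z ∈ l i} (arm N ℬ h y (l i) (b i)), fun i => M.conn_left _ (hv i),
    fun i => M.isConnectedWithin_arm (hb i).1 (fun z hz => (hl i z hz).1)
      (hchain i).left_of_append ((hbl i).imp_right And.left),
    fun i k hik => M.disj_left _ (hv i) _ (hv k) ?_,
    fun i j hij => ?_, fun i j => ?_, fun i j => ?_⟩
  · fin_cases i <;> fin_cases k <;> first | exact (hik rfl).elim | simp [*, Ne.symm]
  · refine M.disjoint_branchUnion (fun z hz => (hl i z hz).1) (fun z hz => (hl j z hz).1) (harm i)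
      (harm j) (Set.disjoint_left.2 (hll i j hij)) (Set.disjoint_left.2 ?_)
    have hxarm : ∀ i c, x ∈ N c → ¬ (∀ z ∈ N c, z = h ∨ z = y ∨ z ∈ l i) := by
      intro i c hxc hc
      rcases hc x hxc with h | h | h
      exacts [hxh h, hxy h, (hl i x h).2.2.1 rfl]
    rintro c (rfl | ⟨hc, -, hci⟩) (hcj | ⟨-, -, hcj⟩)
    · exact hbb i j hij hcj
    · exact hxarm j _ (hb i).2.2 hcj
    · exact hxarm i c (hcj ▸ (hb j).2.2) hci
    · obtain ⟨z, hz, hzh, hzy⟩ := M.exists_third hc h y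
      exact hll i j hij z (((hci z hz).resolve_left hzh).resolve_left hzy)
        (((hcj z hz).resolve_left hzh).resolve_left hzy)
  · simp only [branchUnion, Set.disjoint_union_right, Set.disjoint_iUnion_right]
    refine ⟨fun z hz => M.disj_left _ (hv i) _ (hl j z hz).1 ?_,
      fun c hc => M.disj _ (hv i) _ (harm j hc)⟩
    have := (hl j z hz).2
    fin_cases i
    exacts [this.1.symm, this.2.1.symm, this.2.2.symm]
  · have hadj : ∀ c ∈ arm N ℬ h y (l j) (b j), ∀ a ∈ N c, ∃ u ∈ P a,
        ∃ v ∈ branchUnion P Q {z | z ∈ l j} (arm N ℬ h y (l j) (b j)), G.Adj u v := by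
      intro c hc a ha
      obtain ⟨u, hu, v, hv, huv⟩ := M.adj c (harm j hc) a ha
      exact ⟨u, hu, v, Or.inr (Set.mem_biUnion hc hv), huv⟩
    fin_cases i
    · exact hadj (b j) (Or.inl rfl) h (hb j).2.1
    · exact hadj (b j) (Or.inl rfl) x (hb j).2.2
    · rcases hbl j with ⟨z, -, hz⟩ | ⟨-, hy⟩
      · have hne : l j ≠ [] := List.ne_nil_of_mem hz
        have hlast := (hchain j).rel_getLast_head_of_append hne (by simp)
        obtain ⟨huy, huh, -, c, hc, hhc, huc, hyc⟩ := hlast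
        refine hadj c (Or.inr ⟨hc, hhc, fun w hw => ?_⟩) y hyc
        rcases M.eq_or_eq_or_eq_of_mem hc hhc huc hyc huy huh hyh hw with h | h | h
        exacts [Or.inl h, Or.inr (Or.inr (h ▸ List.getLast_mem hne)), Or.inr (Or.inl h)]
      · exact hadj (b j) (Or.inl rfl) y hy

/-- If any two members of `𝒜` in a common triple lie in at least three common triples, then there
is a minor. The two poles of the theta graph lie on a longest path in the link of a hub. -/
theorem hasThreeByThreeMinor_of_three_le [DecidableEq ι] (M : TripleModel G P Q N 𝒜 ℬ)
    (hne : ℬ.Nonempty)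
    (h3 : ∀ b ∈ ℬ, ∀ a ∈ N b, ∀ a' ∈ N b, a ≠ a' →
      3 ≤ (ℬ.filter fun c => a ∈ N c ∧ a' ∈ N c).card) : HasThreeByThreeMinor G := by
  classical
  obtain ⟨b₀, hb₀⟩ := hne
  obtain ⟨h, hh⟩ : (N b₀).Nonempty := Finset.card_pos.1 (by rw [M.card b₀ hb₀]; omega)
  obtain ⟨x₀, hx₀, hx₀h, -⟩ := M.exists_third hb₀ h h
  let good : List ι → Prop := fun l => l.Nodup ∧ l.IsChain (Link N ℬ h) ∧
    ∀ z ∈ l, z ≠ h ∧ ∃ b ∈ ℬ, h ∈ N b ∧ z ∈ N b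
  have hgood𝒜 : ∀ l, good l → ∀ z ∈ l, z ∈ 𝒜 := fun l hl z hz => by
    obtain ⟨-, b, hb, -, hzb⟩ := hl.2.2 z hz
    exact M.subset b hb hzb
  have hbound : ∀ n, (∃ l, good l ∧ l.length = n) → n ≤ 𝒜.card := by
    rintro _ ⟨l, hl, rfl⟩
    rw [← List.toFinset_card_of_nodup hl.1]
    exact Finset.card_le_card fun z hz => hgood𝒜 l hl z (List.mem_toFinset.1 hz)
  have hone : ∃ l, good l ∧ l.length = 1 :=
    ⟨[x₀], ⟨by simp, by simp, by simpa using ⟨hx₀h, b₀, hb₀, hh, hx₀⟩⟩, rfl⟩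
  set n := Nat.findGreatest (fun n => ∃ l, good l ∧ l.length = n) 𝒜.card with hn
  obtain ⟨l, hl, hln⟩ : ∃ l, good l ∧ l.length = n :=
    Nat.findGreatest_spec (P := fun n => ∃ l, good l ∧ l.length = n) (hbound 1 hone) hone
  have hmax : ∀ l', good l' → l'.length ≤ l.length := fun l' hl' => hln ▸
    Nat.le_findGreatest (hbound _ ⟨l', hl', rfl⟩) ⟨l', hl', rfl⟩
  have hlpos : 1 ≤ l.length := by
    obtain ⟨l₁, hl₁, hlen⟩ := hone
    exact hlen ▸ hmax l₁ hl₁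
  obtain ⟨x, t, rfl⟩ : ∃ x t, l = x :: t := by
    cases l with
    | nil => simp at hlpos
    | cons x t => exact ⟨x, t, rfl⟩
  obtain ⟨hnodup, hchain, hmem⟩ := hl
  obtain ⟨hxt, htnodup⟩ := List.nodup_cons.1 hnodup
  obtain ⟨hxh, b₁, hb₁, hhb₁, hxb₁⟩ := hmem x (by simp)
  have hcard := h3 b₁ hb₁ h hhb₁ x hxb₁ hxh.symm
  set F := ℬ.filter fun c => h ∈ N c ∧ x ∈ N c with hF
  have hy : ∀ c, ∃ y, c ∈ F → y ∈ N c ∧ y ∈ t := by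
    intro c
    by_cases hc : c ∈ F
    · obtain ⟨hcℬ, hhc, hxc⟩ := Finset.mem_filter.1 hc
      obtain ⟨y, hy, hyh, hyx⟩ := M.exists_third hcℬ h x
      refine ⟨y, fun _ => ⟨hy, by_contra fun hyt => ?_⟩⟩
      have := hmax (y :: x :: t) ⟨List.nodup_cons.2 ⟨by simp [hyx, hyt], hnodup⟩,
        List.isChain_cons_cons.2 ⟨⟨hyx, hyh, hxh, c, hcℬ, hhc, hy, hxc⟩, hchain⟩, fun z hz => by
          rcases List.mem_cons.1 hz with rfl | hz
          exacts [⟨hyh, c, hcℬ, hhc, hy⟩, hmem z hz]⟩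
      simp at this
    · exact ⟨x, fun h => (hc h).elim⟩
  choose y hy using hy
  obtain ⟨c₀, hc₀, hmin⟩ := F.exists_min_image (fun c => t.idxOf (y c))
    (Finset.card_pos.1 (by omega))
  have hcard' : 2 ≤ (F.erase c₀).card := by rw [Finset.card_erase_of_mem hc₀]; omega
  obtain ⟨c₂, hc₂, hmax'⟩ := (F.erase c₀).exists_max_image (fun c => t.idxOf (y c))
    (Finset.card_pos.1 (by omega))
  obtain ⟨c₁, hc₁⟩ : ((F.erase c₀).erase c₂).Nonempty :=
    Finset.card_pos.1 (by rw [Finset.card_erase_of_mem hc₂]; omega)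
  obtain ⟨h12, hc₁'⟩ := Finset.mem_erase.1 hc₁
  obtain ⟨h10, hc₁F⟩ := Finset.mem_erase.1 hc₁'
  obtain ⟨h20, hc₂F⟩ := Finset.mem_erase.1 hc₂
  have hle₀ := hmin c₁ hc₁F
  have hle₂ := hmax' c₁ hc₁'
  obtain ⟨l₁, l₂, rfl⟩ := List.append_of_mem (hy c₁ hc₁F).2
  have hy₀ : y c₀ ∈ l₁ ∨ y c₀ = y c₁ := by
    have := (hy c₀ hc₀).2
    grind
  have hy₂ : y c₂ ∈ l₂ ∨ y c₂ = y c₁ := by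
    have := (hy c₂ hc₂F).2
    grind
  have hF' : ∀ c ∈ F, c ∈ ℬ ∧ h ∈ N c ∧ x ∈ N c := fun c hc => Finset.mem_filter.1 hc
  obtain ⟨hch₁, hch₂⟩ := List.isChain_split.1 hchain.tail
  obtain ⟨s₀, hs₀, hsch₀, hsy₀⟩ : ∃ s : List ι, (∀ z ∈ s, z ∈ l₁) ∧
      (s ++ [y c₁]).IsChain (Link N ℬ h) ∧
      ((∃ z ∈ N c₀, z ∈ s) ∨ s = [] ∧ y c₁ ∈ N c₀) := by
    rcases hy₀ with hmem₀ | heq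
    · exact ⟨l₁, fun _ hz => hz, hch₁, Or.inl ⟨_, (hy c₀ hc₀).1, hmem₀⟩⟩
    · exact ⟨[], by simp, by simp, Or.inr ⟨rfl, heq ▸ (hy c₀ hc₀).1⟩⟩
  obtain ⟨s₂, hs₂, hsch₂, hsy₂⟩ : ∃ s : List ι, (∀ z ∈ s, z ∈ l₂) ∧
      (s ++ [y c₁]).IsChain (Link N ℬ h) ∧
      ((∃ z ∈ N c₂, z ∈ s) ∨ s = [] ∧ y c₁ ∈ N c₂) := by
    rcases hy₂ with hmem₂ | heq
    · refine ⟨l₂.reverse, fun _ hz => List.mem_reverse.1 hz, ?_,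
        Or.inl ⟨_, (hy c₂ hc₂F).1, List.mem_reverse.2 hmem₂⟩⟩
      rw [← List.reverse_cons, List.isChain_reverse]
      exact hch₂.imp fun _ _ => Link.symm
    · exact ⟨[], by simp, by simp, Or.inr ⟨rfl, heq ▸ (hy c₂ hc₂F).1⟩⟩
  have hl₁ : ∀ z ∈ l₁, z ∈ 𝒜 ∧ z ≠ h ∧ z ≠ x ∧ z ≠ y c₁ := fun z hz =>
    ⟨hgood𝒜 _ ⟨hnodup, hchain, hmem⟩ z (by simp [hz]), (hmem z (by simp [hz])).1,
      by grind, by grind⟩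
  have hl₂ : ∀ z ∈ l₂, z ∈ 𝒜 ∧ z ≠ h ∧ z ≠ x ∧ z ≠ y c₁ := fun z hz =>
    ⟨hgood𝒜 _ ⟨hnodup, hchain, hmem⟩ z (by simp [hz]), (hmem z (by simp [hz])).1,
      by grind, by grind⟩
  have hdis : ∀ z ∈ l₁, z ∉ l₂ := by grind
  have hycℬ := M.subset c₁ (hF' c₁ hc₁F).1 (hy c₁ hc₁F).1
  refine M.hasThreeByThreeMinor_of_arms (h := h) (x := x) (y := y c₁)
    (M.subset b₁ hb₁ hhb₁) (M.subset b₁ hb₁ hxb₁) hycℬ hxh (hmem (y c₁) (by simp)).1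
    (by grind) ![s₀, [], s₂] ![c₀, c₁, c₂] ?_ ?_ ?_ ?_ ?_ ?_
  · intro i z hz
    fin_cases i
    exacts [hl₁ z (hs₀ z hz), by simp at hz, hl₂ z (hs₂ z hz)]
  · intro i j hij z hz hz'
    fin_cases i <;> fin_cases j <;> simp at hij hz hz'
    exacts [hdis z (hs₀ z hz) (hs₂ z hz'), hdis z (hs₀ z hz') (hs₂ z hz)]
  · intro i j hij
    fin_cases i <;> fin_cases j <;> first | exact (hij rfl).elim | simp [*, Ne.symm]
  · intro i
    fin_cases i
    exacts [hF' c₀ hc₀, hF' c₁ hc₁F, hF' c₂ hc₂F]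
  · intro i
    fin_cases i
    exacts [hsch₀, by simp, hsch₂]
  · intro i
    fin_cases i
    exacts [hsy₀, Or.inr ⟨rfl, (hy c₁ hc₁F).1⟩, hsy₂]

theorem hasThreeByThreeMinor_of_two_mul_card_lt [DecidableEq ι] (M : TripleModel G P Q N 𝒜 ℬ)
    (hcard : 2 * 𝒜.card < ℬ.card) : HasThreeByThreeMinor G := by
  induction hn : 𝒜.card generalizing P N 𝒜 ℬ with
  | zero =>
    obtain ⟨b, hb⟩ := Finset.card_pos.1 (by omega : 0 < ℬ.card)
    have := Finset.card_le_card (M.subset b hb)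
    rw [M.card b hb] at this
    omega
  | succ n ih =>
    by_cases h3 : ∀ b ∈ ℬ, ∀ a ∈ N b, ∀ a' ∈ N b, a ≠ a' →
        3 ≤ (ℬ.filter fun c => a ∈ N c ∧ a' ∈ N c).card
    · exact M.hasThreeByThreeMinor_of_three_le (Finset.card_pos.1 (by omega)) h3
    · push Not at h3
      obtain ⟨b, hb, a, ha, a', ha', hne, hlt⟩ := h3
      have hsplit := ℬ.card_filter_add_card_filter_not fun c => a ∈ N c ∧ a' ∈ N c
      have herase : (𝒜.erase a').card = n := by
        rw [Finset.card_erase_of_mem (M.subset b hb ha'), hn]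
        rfl
      exact ih (M.contract hb ha ha' hne) (by omega) herase

end TripleModel

/-- A connected component of an induced subgraph is connected within its vertex set. -/
theorem isConnectedWithin_component {V : Type*} {G : SimpleGraph V} {S : Set V}
    (K : (G.induce S).ConnectedComponent) :
    IsConnectedWithin G {v | ∃ h : v ∈ S, (G.induce S).connectedComponentMk ⟨v, h⟩ = K} := by
  have key : ∀ u v : S, (G.induce S).Walk u v → ReachableWithin G
      {w | ∃ h : w ∈ S, (G.induce S).connectedComponentMk ⟨w, h⟩ =
        (G.induce S).connectedComponentMk v} u v := by
    intro u v w
    induction w with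
    | nil => exact .refl ⟨Subtype.property _, rfl⟩
    | @cons u w v huw p ih =>
      have hu := SimpleGraph.ConnectedComponent.sound (huw.reachable.trans p.reachable)
      have hadj : G.Adj (u : V) (w : V) := by simpa using huw
      refine ReachableWithin.trans (v := (w : V)) (.of_adj ?_ ih.mem_left hadj) ih
      exact ⟨u.2, hu⟩
  rintro u ⟨hu, huK⟩ v ⟨hv, rfl⟩
  obtain ⟨w⟩ := SimpleGraph.ConnectedComponent.exact huK
  exact key _ _ w

/-- In a finite simple planar graph `G` with a vertex set `A`, at most `2·|A|` connected
components of the subgraph induced by the complement of `A` are adjacent (in `G`) to more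
than two vertices of `A`. -/
theorem card_components_adjacent_to_many_le {V : Type} [Fintype V] [DecidableEq V]
    (G : SimpleGraph V) (hG : Nonempty (PlanarDrawing G)) (A : Finset V) :
    {K : (G.induce ((↑A : Set V)ᶜ)).ConnectedComponent |
        2 < {a : V | a ∈ A ∧ ∃ v : ((↑A : Set V)ᶜ : Set V),
              (G.induce ((↑A : Set V)ᶜ)).connectedComponentMk v = K ∧ G.Adj ↑v a}.ncard}.ncard
      ≤ 2 * A.card := by
  classical
  obtain ⟨D⟩ := hG
  set S : Set V := (↑A : Set V)ᶜ
  let Q : (G.induce S).ConnectedComponent → Set V :=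
    fun K => {v | ∃ h : v ∈ S, (G.induce S).connectedComponentMk ⟨v, h⟩ = K}
  let nbr : (G.induce S).ConnectedComponent → Finset V :=
    fun K => A.filter fun a => ∃ v ∈ Q K, G.Adj v a
  have hnbr : ∀ K : (G.induce S).ConnectedComponent, {a : V | a ∈ A ∧ ∃ v : S,
      (G.induce S).connectedComponentMk v = K ∧ G.Adj ↑v a}.ncard = (nbr K).card := by
    intro K
    rw [← Set.ncard_coe_finset]
    congr 1
    ext a
    simp [nbr, Q]
  have hN : ∀ K, ∃ t ⊆ nbr K, 3 ≤ (nbr K).card → t.card = 3 := by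
    intro K
    by_cases hK : 3 ≤ (nbr K).card
    · obtain ⟨t, ht, htc⟩ := Finset.exists_subset_card_eq hK
      exact ⟨t, ht, fun _ => htc⟩
    · exact ⟨∅, by simp, fun h => (hK h).elim⟩
  choose N hNsub hNcard using hN
  by_contra! hlt
  let ℬ : Finset (G.induce S).ConnectedComponent := Finset.univ.filter fun K => 2 < (nbr K).card
  have hℬ : 2 * A.card < ℬ.card := by
    simp only [hnbr] at hlt
    rwa [← Set.ncard_coe_finset ℬ, Finset.coe_filter_univ]
  have M : TripleModel G (fun a => {a}) Q N A ℬ := by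
    refine ⟨fun a _ => Set.singleton_nonempty a, ?_, fun K _ => isConnectedWithin_component K, ?_,
      ?_, ?_, fun K _ a ha => (Finset.mem_filter.1 (hNsub K ha)).1,
      fun K hK => hNcard K (Finset.mem_filter.1 hK).2, ?_⟩
    · rintro a - u rfl v rfl
      exact .refl rfl
    · exact fun a _ a' _ hne => Set.disjoint_singleton.2 hne
    · rintro K - K' - hne
      refine Set.disjoint_left.2 ?_
      rintro v ⟨hv, rfl⟩ ⟨_, rfl⟩
      exact hne rfl
    · rintro a ha K -
      exact Set.disjoint_singleton_left.2 fun ⟨h, _⟩ => h ha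
    · intro K _ a ha
      obtain ⟨-, v, hv, hva⟩ := Finset.mem_filter.1 (hNsub K ha)
      exact ⟨a, rfl, v, hv, hva.symm⟩
  exact D.not_hasThreeByThreeMinor (M.hasThreeByThreeMinor_of_two_mul_card_lt hℬ)
end
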